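/- arXiv:1411.2499 — 4 statements merged into one kernel-verified Lean document; each statement's English description precedes it below -/
import Mathlib

section
/- Let S and S' be families of sets over some type such that S ⊆ S', every member of S is nonempty, and every member of S' \ S contains (as a subset) some member of S. Then a set H is a minimal hitting set for S if and only if H is a minimal hitting set for S'. -/
/-- `H` is a hitting set for the family `S`: `H ⊆ ⋃₀ S` and `H` meets every member of `S`. -/
def IsHittingSet {α : Type*} (S : Set (Set α)) (H : Set α) : Prop :=
  H ⊆ ⋃₀ S ∧ ∀ X ∈ S, H ∩ X ≠ ∅

/-- `H` is a minimal hitting set for `S`: it is a hitting set and no proper subset is one. -/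
def IsMinimalHittingSet {α : Type*} (S : Set (Set α)) (H : Set α) : Prop :=
  IsHittingSet S H ∧ ∀ H' ⊂ H, ¬ IsHittingSet S H'

theorem IsHittingSet.of_subset_of_forall_superset {α : Type*} {S S' : Set (Set α)} {H : Set α}
    (hSS' : S ⊆ S') (hsup : ∀ X ∈ S' \ S, ∃ Y ∈ S, Y ⊆ X) (h : IsHittingSet S H) :
    IsHittingSet S' H := by
  refine ⟨h.1.trans (Set.sUnion_subset_sUnion hSS'), fun X hX => ?_⟩
  by_cases hXS : X ∈ S
  · exact h.2 X hXS
  · obtain ⟨Y, hY, hYX⟩ := hsup X ⟨hX, hXS⟩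
    exact ((Set.nonempty_iff_ne_empty.2 (h.2 Y hY)).mono
      (Set.inter_subset_inter_right H hYX)).ne_empty

theorem isHittingSet_inter_sUnion {α : Type*} {S : Set (Set α)} {H : Set α}
    (h : ∀ X ∈ S, H ∩ X ≠ ∅) : IsHittingSet S (H ∩ ⋃₀ S) := by
  refine ⟨Set.inter_subset_right, fun X hX => ?_⟩
  rw [Set.inter_assoc, Set.inter_eq_right.2 (Set.subset_sUnion_of_mem hX)]
  exact h X hX

theorem minimal_hitting_set_iff {α : Type*} (S S' : Set (Set α))
    (hSS' : S ⊆ S')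
    (hne : ∀ X ∈ S, X.Nonempty)
    (hsup : ∀ X ∈ S' \ S, ∃ Y ∈ S, Y ⊆ X)
    (H : Set α) :
    IsMinimalHittingSet S H ↔ IsMinimalHittingSet S' H := by
  constructor
  · rintro ⟨hH, hmin⟩
    exact ⟨hH.of_subset_of_forall_superset hSS' hsup, fun H' hlt h' =>
      hmin H' hlt ⟨hlt.subset.trans hH.1, fun X hX => h'.2 X (hSS' hX)⟩⟩
  · rintro ⟨hH, hmin⟩
    have hmeet : ∀ X ∈ S, H ∩ X ≠ ∅ := fun X hX => hH.2 X (hSS' hX)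
    have hsub : H ⊆ ⋃₀ S := by
      by_contra hn
      exact hmin (H ∩ ⋃₀ S) (Set.inter_ssubset_left_iff.2 hn)
        ((isHittingSet_inter_sUnion hmeet).of_subset_of_forall_superset hSS' hsup)
    exact ⟨⟨hsub, hmeet⟩, fun H' hlt h' =>
      hmin H' hlt (h'.of_subset_of_forall_superset hSS' hsup)⟩
end

section
/- Let S and S' be families of sets over some type such that S ⊆ S', every member of S is nonempty, and every member of S' \ S contains (as a subset) some member of S. Then every minimal hitting set H for S' satisfies H ⊆ ⋃₀ S. -/
theorem minimal_hitting_set_subset_sUnion {α : Type*} (S S' : Set (Set α))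
    (hSS' : S ⊆ S')
    (hne : ∀ X ∈ S, X.Nonempty)
    (hsup : ∀ X ∈ S' \ S, ∃ Y ∈ S, Y ⊆ X)
    (H : Set α) :
    IsMinimalHittingSet S' H → H ⊆ ⋃₀ S := by
  rintro ⟨⟨hHsub, hHmeet⟩, hmin⟩
  have key : ∀ Y ∈ S, ((H ∩ ⋃₀ S) ∩ Y).Nonempty := fun Y hY => by
    obtain ⟨y, hyH, hyY⟩ := Set.nonempty_iff_ne_empty.mpr (hHmeet Y (hSS' hY))
    exact ⟨y, ⟨hyH, Y, hY, hyY⟩, hyY⟩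
  by_contra hnot
  refine hmin (H ∩ ⋃₀ S) ⟨Set.inter_subset_left, fun h => hnot fun x hx => (h hx).2⟩
    ⟨Set.inter_subset_left.trans hHsub, fun X hX => Set.nonempty_iff_ne_empty.mp ?_⟩
  by_cases hXS : X ∈ S
  · exact key X hXS
  · obtain ⟨Y, hY, hYX⟩ := hsup X ⟨hX, hXS⟩
    exact (key Y hY).mono (Set.inter_subset_inter_right _ hYX)
end

section
/- Let L be a first-order language, let KB_I and KB_U be disjoint sets of L-sentences, let KB = KB_I ∪ KB_U, and let α be an L-sentence whose negation is not a semantic consequence of the empty theory (i.e., α is satisfiable). Suppose Δ ⊆ KB_U is a KB-closed locally minimal abductive explanation for α with respect to KB_I, i.e., there exists a set B that is minimal with respect to inclusion among the subsets B' of KB_I satisfying both B' ∪ Δ ⊨ α and that no proper subset Δ' ⊊ Δ satisfies B' ∪ Δ' ⊨ α. Then there exists an α-kernel X of KB, i.e., a set X ⊆ KB with X ⊨ α such that no proper subset of X semantically entails α, satisfying X ∩ KB_U = Δ. -/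
open FirstOrder

theorem FirstOrder.Language.Theory.ModelsBoundedFormula.of_subset {L : Language}
    {T T' : L.Theory} {ι : Type*} {n : ℕ} {φ : L.BoundedFormula ι n}
    (h : T ⊨ᵇ φ) (hT : T ⊆ T') : T' ⊨ᵇ φ :=
  fun M v xs => h (M.subtheoryModel hT) v xs

theorem kernel_of_locally_minimal_abductive_explanation
    {L : Language} (KB_I KB_U : Set L.Sentence)
    (hdisj : Disjoint KB_I KB_U)
    (α : L.Sentence)
    (hα : ¬ (∅ : L.Theory) ⊨ᵇ α.not)
    (Δ : Set L.Sentence) (hΔU : Δ ⊆ KB_U)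
    (hloc : ∃ B, Minimal (fun B' : Set L.Sentence =>
        B' ⊆ KB_I ∧ (B' ∪ Δ) ⊨ᵇ α ∧ ∀ Δ' ⊂ Δ, ¬ (B' ∪ Δ') ⊨ᵇ α) B) :
    ∃ X ⊆ KB_I ∪ KB_U, X ⊨ᵇ α ∧ (∀ X' ⊂ X, ¬ X' ⊨ᵇ α) ∧ X ∩ KB_U = Δ := by
  obtain ⟨B, ⟨hBI, hB, hΔmin⟩, hBmin⟩ := hloc
  refine ⟨B ∪ Δ, Set.union_subset_union hBI hΔU, hB, ?_, ?_⟩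
  · intro X hX hXα
    have hΔX : Δ ⊆ X := by
      by_contra hΔX
      refine hΔmin (X ∩ Δ) ⟨Set.inter_subset_right, fun h => hΔX fun x hx => (h hx).1⟩
        (hXα.of_subset fun x hx => ?_)
      exact (hX.1 hx).imp_right fun hxΔ => ⟨hx, hxΔ⟩
    have hBX : B ⊆ X ∩ B := by
      refine hBmin ⟨Set.inter_subset_right.trans hBI, hXα.of_subset fun x hx => ?_,
        fun Δ' hΔ' h => hΔmin Δ' hΔ' (h.of_subset ?_)⟩ Set.inter_subset_right
      · exact (hX.1 hx).imp_left fun hxB => ⟨hx, hxB⟩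
      · exact Set.union_subset_union_left Δ' Set.inter_subset_right
    exact hX.2 (Set.union_subset (fun x hx => (hBX hx).1) hΔX)
  · rw [Set.union_inter_distrib_right, (hdisj.mono_left hBI).inter_eq, Set.empty_union,
      Set.inter_eq_left.mpr hΔU]
end

section
/- Let L be a first-order language, let KB_I and KB_U be disjoint sets of L-sentences, let KB = KB_I ∪ KB_U, and let α be an L-sentence whose negation is not a semantic consequence of the empty theory (i.e., α is satisfiable). If X is an α-kernel of KB, i.e., X ⊆ KB, X ⊨ α, and no proper subset of X semantically entails α, then Δ = X ∩ KB_U is a KB-closed locally minimal abductive explanation for α with respect to KB_I; that is, there exists a set B (namely B = X ∩ KB_I) that is minimal with respect to inclusion among the subsets B' of KB_I satisfying both B' ∪ Δ ⊨ α and that no proper subset Δ' ⊊ Δ satisfies B' ∪ Δ' ⊨ α. -/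
open FirstOrder

theorem locally_minimal_abductive_explanation_of_kernel
    {L : Language} (KB_I KB_U : Set L.Sentence)
    (hdisj : Disjoint KB_I KB_U)
    (α : L.Sentence)
    (hα : ¬ (∅ : L.Theory) ⊨ᵇ α.not)
    (X : Set L.Sentence) (hXKB : X ⊆ KB_I ∪ KB_U)
    (hXα : X ⊨ᵇ α) (hXmin : ∀ X' ⊂ X, ¬ X' ⊨ᵇ α) :
    Minimal (fun B' : Set L.Sentence =>
        B' ⊆ KB_I ∧ (B' ∪ (X ∩ KB_U)) ⊨ᵇ α ∧
          ∀ Δ' ⊂ X ∩ KB_U, ¬ (B' ∪ Δ') ⊨ᵇ α) (X ∩ KB_I) := by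
  have hX : X ∩ KB_I ∪ X ∩ KB_U = X := by
    rw [← Set.inter_union_distrib_left, Set.inter_eq_left.mpr hXKB]
  refine ⟨⟨Set.inter_subset_right, by rwa [hX], fun Δ' hΔ' => hXmin _ ?_⟩, ?_⟩
  · obtain ⟨hsub, x, hx, hxΔ'⟩ := Set.ssubset_iff_exists.mp hΔ'
    refine Set.ssubset_iff_exists.mpr
      ⟨Set.union_subset Set.inter_subset_left (hsub.trans Set.inter_subset_left), x, hx.1, ?_⟩
    rintro (h | h)
    · exact Set.disjoint_left.mp hdisj h.2 hx.2
    · exact hxΔ' h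
  · rintro B' ⟨-, hB'α, -⟩ hB' x hx
    by_contra hxB'
    refine hXmin _ (Set.ssubset_iff_exists.mpr
      ⟨Set.union_subset (hB'.trans Set.inter_subset_left) Set.inter_subset_left, x, hx.1, ?_⟩) hB'α
    rintro (h | h)
    · exact hxB' h
    · exact Set.disjoint_left.mp hdisj hx.2 h.2
end
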